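/- Let m ≥ 2 and q = m − 1 + C(2m, m). The eigenvalues of the intensity matrix A_{q−m−1} of the reduced Pólya urn (with the dead type and the m single-root types removed) used to count protected nodes in the random m-ary search tree are, counted with algebraic multiplicity, the roots of the polynomial φ_m(λ) = Π_{i=1}^{m−1}(λ + i) − m! together with the multiset {−a_i : i = m, m+1, …, q − m − 1}. -/

import Mathlib

open scoped BigOperators

namespace ProtUrn

/-- The composite types of the protected-nodes urn for `m`-ary search trees are
described by vectors `x : Fin m → ℕ` (with `Σ x ≤ m`), where `x i` is the number of
children of the (full) root holding `i` keys. `val` reads such a vector as a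
base-`(m+1)` number with `x 0` most significant. -/
def val (m : ℕ) (x : Fin m → ℕ) : ℕ := ∑ i, x i * (m + 1) ^ (m - 1 - (i : ℕ))

/-- The enumeration order on composite types: types with more children precede
types with fewer children, ties broken by decreasing base-`(m+1)` value. -/
def OrdGT (m : ℕ) (x y : Fin m → ℕ) : Prop :=
  (∑ i, y i) < (∑ i, x i) ∨ ((∑ i, x i) = (∑ i, y i) ∧ val m y < val m x)

/-- The activity (number of gaps) of a composite type: each child holding `i` keys
contributes `i + 1` gaps. -/
def activity (m : ℕ) (x : Fin m → ℕ) : ℕ := ∑ i : Fin m, ((i : ℕ) + 1) * x i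

/-- Add one child with `c` keys. -/
def addE (m : ℕ) (x : Fin m → ℕ) (c : ℕ) : Fin m → ℕ :=
  fun i => if (i : ℕ) = c then x i + 1 else x i

/-- Remove one child with `c` keys. -/
def subE (m : ℕ) (x : Fin m → ℕ) (c : ℕ) : Fin m → ℕ :=
  fun i => if (i : ℕ) = c then x i - 1 else x i

/-- The type `(m, 0, …, 0)`: a full root with `m` external children. -/
def fullVec (m : ℕ) : Fin m → ℕ := fun i => if (i : ℕ) = 0 then m else 0

/-- The type `(m−1, 1, 0, …, 0)` created when a full child becomes a non-leaf. -/
def spawnVec (m : ℕ) : Fin m → ℕ :=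
  fun i => if (i : ℕ) = 0 then m - 1 else if (i : ℕ) = 1 then 1 else 0

/-- Deleting the root of a composite type `x` in the urn reduced to `k` types:
each child holding `c ≤ m − 2` keys becomes a single node (type `c`, `0`-indexed),
each full child becomes a ball of type `m − 1` (the type `(m, 0, …, 0)`); if
`k = m − 1` the latter type is absent and each full child is further replaced by its
`m` external children. -/
noncomputable def singles (m k : ℕ) (hm : 2 ≤ m) (x : Fin m → ℕ) : Fin k → ℝ := fun i =>
  if h : (i : ℕ) < m - 1 then
    (x ⟨(i : ℕ), by omega⟩ : ℝ) +
      (if k < m ∧ (i : ℕ) = 0 then (m : ℝ) * (x ⟨m - 1, by omega⟩ : ℝ) else 0)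
  else if (i : ℕ) = m - 1 then (x ⟨m - 1, by omega⟩ : ℝ) else 0

/-- The vector of balls representing a composite type `x` in the urn reduced to the
types `0, …, k − 1` (global index of `x` is `m − 1 + τ⁻¹ x`): keep it if its index
is `< k`, otherwise delete the root. -/
noncomputable def red (m N : ℕ) (hm : 2 ≤ m) (τinv : (Fin m → ℕ) → Fin N) (k : ℕ)
    (x : Fin m → ℕ) : Fin k → ℝ := fun i =>
  if m - 1 + (τinv x : ℕ) < k then (if (i : ℕ) = m - 1 + (τinv x : ℕ) then 1 else 0)
  else singles m k hm x i

/-- The intensity matrix `A_k = (a_j E ξ^{(k)}_{ji})` of the reduced Pólya urn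
`𝒳_n^k` used to count protected nodes in random `m`-ary search trees. Types
(0-indexed): type `i < m − 1` is a single node with `i` keys (activity `i + 1`);
type `m − 1 + s` is the composite type `τ s` (activity `Σ_i (i+1) (τ s) i`). When a
ball is drawn, a key is inserted into a uniformly chosen gap: a single node gains a
key (becoming the full type `(m, 0, …, 0)` when it had `m − 2` keys); in a composite
type, a child with `c ≤ m − 2` keys (chosen with probability proportional to its
`c + 1` gaps) gains a key, while inserting into one of the `m` gaps of a full child
splits off a new tree of type `(m−1, 1, 0, …, 0)`; the resulting types are reduced
(roots of types `≥ k` are deleted), and the drawn ball counts as removed. -/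
noncomputable def intensityProt (m N : ℕ) (hm : 2 ≤ m) (τ : Fin N → Fin m → ℕ)
    (τinv : (Fin m → ℕ) → Fin N) (k : ℕ) (hk : k ≤ m - 1 + N) :
    Matrix (Fin k) (Fin k) ℝ :=
  Matrix.of fun i j =>
    if hj1 : (j : ℕ) < m - 2 then
      (((j : ℕ) : ℝ) + 1) *
        ((if (i : ℕ) = (j : ℕ) + 1 then 1 else 0) - (if i = j then 1 else 0))
    else if hj2 : (j : ℕ) = m - 2 then
      ((m : ℝ) - 1) * (red m N hm τinv k (fullVec m) i - (if i = j then 1 else 0))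
    else
      (∑ c : Fin (m - 1),
        (((c : ℕ) : ℝ) + 1) *
          ((τ ⟨(j : ℕ) - (m - 1), by have := j.isLt; omega⟩) (Fin.castLE (by omega) c) : ℝ) *
          red m N hm τinv k
            (addE m (subE m (τ ⟨(j : ℕ) - (m - 1), by have := j.isLt; omega⟩) (c : ℕ))
              ((c : ℕ) + 1)) i)
      + (m : ℝ) * ((τ ⟨(j : ℕ) - (m - 1), by have := j.isLt; omega⟩) ⟨m - 1, by omega⟩ : ℝ) *
          (red m N hm τinv k
              (subE m (τ ⟨(j : ℕ) - (m - 1), by have := j.isLt; omega⟩) (m - 1)) i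
            + red m N hm τinv k (spawnVec m) i)
      - (activity m (τ ⟨(j : ℕ) - (m - 1), by have := j.isLt; omega⟩) : ℝ) *
          (if i = j then 1 else 0)

/-- The activity of the type with global index `i` in the reduced urn. -/
noncomputable def actGlobal (m N : ℕ) (τ : Fin N → Fin m → ℕ) (k : ℕ)
    (hk : k ≤ m - 1 + N) (i : Fin k) : ℝ :=
  if h : (i : ℕ) < m - 1 then ((i : ℕ) : ℝ) + 1
  else ((activity m (τ ⟨(i : ℕ) - (m - 1), by have := i.isLt; omega⟩) : ℕ) : ℝ)

end ProtUrn

namespace ProtUrn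

open Polynomial

lemma det_bidiagonal_add_corner {R : Type*} [CommRing R] (n : ℕ) (d s : ℕ → R) (r : R) :
    (Matrix.of fun i j : Fin (n + 1) =>
      (if i = j then d i else 0) + (if (i : ℕ) = j + 1 then s j else 0)
        + (if i = 0 ∧ j = Fin.last n then r else 0)).det
      = ∏ i : Fin (n + 1), d i + (-1) ^ n * r * ∏ j : Fin n, s j := by
  set L : Matrix (Fin (n + 1)) (Fin (n + 1)) R := Matrix.of fun i j =>
    (if i = j then d i else 0) + (if (i : ℕ) = j + 1 then s j else 0) with hL
  have hsplit : (Matrix.of fun i j : Fin (n + 1) =>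
      (if i = j then d i else 0) + (if (i : ℕ) = j + 1 then s j else 0)
        + (if i = 0 ∧ j = Fin.last n then r else 0))
      = L.updateRow 0 (L 0 + r • Pi.single (Fin.last n) 1) := by
    ext i j
    by_cases hi : i = 0
    · subst hi
      by_cases hj : j = Fin.last n <;> simp [hL, hj]
    · simp [hL, hi]
  have hdiag : L.det = ∏ i : Fin (n + 1), d i := by
    rw [Matrix.det_of_isLowerTriangular]
    · simp [hL]
    · intro i j hij
      have hij : (i : ℕ) < j := hij
      have h1 : i ≠ j := fun h => by simp [h] at hij
      have h2 : (i : ℕ) ≠ j + 1 := by omega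
      simp [hL, h1, h2]
  have hcorner : (L.updateRow 0 (Pi.single (Fin.last n) 1)).det
      = (-1) ^ n * ∏ j : Fin n, s j := by
    rw [Matrix.det_succ_row_zero, Finset.sum_eq_single (Fin.last n)]
    · have : ((L.updateRow 0 (Pi.single (Fin.last n) 1)).submatrix Fin.succ
          (Fin.last n).succAbove).det = ∏ j : Fin n, s j := by
        rw [Matrix.det_of_isUpperTriangular]
        · refine Finset.prod_congr rfl fun j _ => ?_
          have : j.succ ≠ j.castSucc := fun h => by simpa using congrArg Fin.val h
          simp [hL, this]
        · intro i j hij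
          have hij : (j : ℕ) < i := hij
          have h1 : i.succ ≠ j.castSucc := fun h => by
            have := congrArg Fin.val h
            simp at this; omega
          have h2 : (i : ℕ) ≠ j := by omega
          simp [hL, h1, h2]
      rw [this]
      simp
    · intro j _ hj
      simp [hj]
    · simp
  rw [hsplit, Matrix.det_updateRow_add, Matrix.det_updateRow_smul, Matrix.updateRow_eq_self,
    hdiag, hcorner]
  ring

lemma charpoly_eq_of_mul_eq_mul {ι : Type*} [Fintype ι] [DecidableEq ι]
    {A Q M : Matrix ι ι ℝ} (hQ : IsUnit Q.det) (h : A * Q = Q * M) : A.charpoly = M.charpoly := by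
  have : A = Q * M * Q⁻¹ := by
    rw [← h, Matrix.mul_assoc, Matrix.mul_nonsing_inv _ hQ, Matrix.mul_one]
  obtain ⟨u, rfl⟩ := (Matrix.isUnit_iff_isUnit_det Q).2 hQ
  rw [this, Matrix.charpoly_units_conj]

lemma sum_fin_eq_sum_castLE_add {m : ℕ} (hm : 2 ≤ m) (f : Fin m → ℝ) :
    ∑ c, f c = ∑ c : Fin (m - 1), f (Fin.castLE (by omega) c) + f ⟨m - 1, by omega⟩ := by
  obtain ⟨n, rfl⟩ : ∃ n, m = n + 1 := ⟨m - 1, by omega⟩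
  exact Fin.sum_univ_castSucc f

lemma sum_mul_ite_val_eq {k : ℕ} (f : Fin k → ℝ) (n : ℕ) :
    ∑ i, f i * (if (i : ℕ) = n then 1 else 0) = if h : n < k then f ⟨n, h⟩ else 0 := by
  split_ifs with h
  · rw [Finset.sum_eq_single ⟨n, h⟩]
    · simp
    · intro i _ hi
      have : (i : ℕ) ≠ n := fun h' => hi (Fin.ext h')
      simp [this]
    · simp
  · refine Finset.sum_eq_zero fun i _ => ?_
    have : (i : ℕ) ≠ n := by omega
    simp [this]

lemma singles_apply {m k : ℕ} (hm : 2 ≤ m) (hk : m ≤ k) (x : Fin m → ℕ) (i : Fin k) :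
    singles m k hm x i = if h : (i : ℕ) < m then (x ⟨i, h⟩ : ℝ) else 0 := by
  unfold singles
  have hk' : ¬ k < m := by omega
  by_cases h1 : (i : ℕ) < m - 1
  · have h2 : (i : ℕ) < m := by omega
    simp [h1, h2, hk']
  · by_cases h2 : (i : ℕ) = m - 1
    · have h3 : m - 1 < m := by omega
      simp [h2, h3]
    · have h3 : ¬ (i : ℕ) < m := by omega
      simp [h1, h2, h3]

lemma sum_mul_singles {m k : ℕ} (hm : 2 ≤ m) (hk : m ≤ k) (f : Fin k → ℝ) (x : Fin m → ℕ) :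
    ∑ i, f i * singles m k hm x i = ∑ c, f (Fin.castLE hk c) * (x c : ℝ) := by
  symm
  refine Fintype.sum_of_injective (Fin.castLE hk) (Fin.castLE_injective hk) _ _ ?_ ?_
  · intro i hi
    have : ¬ (i : ℕ) < m := fun h => hi ⟨⟨i, h⟩, rfl⟩
    simp [singles_apply hm hk, this]
  · intro c
    simp [singles_apply hm hk]

lemma singles_subE {m k : ℕ} (hm : 2 ≤ m) (hk : m ≤ k) (x : Fin m → ℕ) (c : Fin m)
    (hc : x c ≠ 0) (i : Fin k) :
    singles m k hm (subE m x c) i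
      = singles m k hm x i - if (i : ℕ) = c then 1 else 0 := by
  simp only [singles_apply hm hk, subE]
  by_cases h : (i : ℕ) = c
  · have h' : 1 ≤ x c := Nat.one_le_iff_ne_zero.2 hc
    simp [h, Nat.cast_sub h']
  · simp [h]

lemma singles_addE {m k : ℕ} (hm : 2 ≤ m) (hk : m ≤ k) (x : Fin m → ℕ) {c : ℕ}
    (hc : c < m) (i : Fin k) :
    singles m k hm (addE m x c) i
      = singles m k hm x i + if (i : ℕ) = c then 1 else 0 := by
  simp only [singles_apply hm hk, addE]
  by_cases h : (i : ℕ) = c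
  · simp [h, hc]
  · simp [h]

lemma singles_fullVec {m k : ℕ} (hm : 2 ≤ m) (hk : m ≤ k) (i : Fin k) :
    singles m k hm (fullVec m) i = if (i : ℕ) = 0 then (m : ℝ) else 0 := by
  simp only [singles_apply hm hk, fullVec]
  by_cases h : (i : ℕ) = 0
  · have : 0 < m := by omega
    simp [h, this]
  · simp [h]

lemma sum_addE {m : ℕ} (x : Fin m → ℕ) {c : ℕ} (hc : c < m) :
    ∑ i, addE m x c i = ∑ i, x i + 1 := by
  have : ∀ i, addE m x c i = x i + if i = ⟨c, hc⟩ then 1 else 0 := fun i => by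
    by_cases h : (i : ℕ) = c <;> simp [addE, h, Fin.ext_iff]
  simp [this, Finset.sum_add_distrib]

lemma sum_subE {m : ℕ} (x : Fin m → ℕ) (c : Fin m) (hc : x c ≠ 0) :
    ∑ i, subE m x c i + 1 = ∑ i, x i := by
  rw [← sum_addE _ c.isLt]
  refine Finset.sum_congr rfl fun i _ => ?_
  by_cases h : i = c
  · subst h
    simp only [addE, subE, if_true]
    omega
  · have : (i : ℕ) ≠ c := fun h' => h (Fin.ext h')
    simp [addE, subE, this]

lemma val_addE {m : ℕ} (x : Fin m → ℕ) {c : ℕ} (hc : c < m) :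
    val m (addE m x c) = val m x + (m + 1) ^ (m - 1 - c) := by
  have : ∀ i : Fin m, addE m x c i * (m + 1) ^ (m - 1 - (i : ℕ))
      = x i * (m + 1) ^ (m - 1 - (i : ℕ))
        + if i = ⟨c, hc⟩ then (m + 1) ^ (m - 1 - c) else 0 := fun i => by
    by_cases h : (i : ℕ) = c
    · simp [addE, h, Fin.ext_iff, add_mul]
    · simp [addE, h, Fin.ext_iff]
  simp [val, this, Finset.sum_add_distrib]

lemma val_subE {m : ℕ} (x : Fin m → ℕ) (c : Fin m) (hc : x c ≠ 0) :
    val m (subE m x c) + (m + 1) ^ (m - 1 - (c : ℕ)) = val m x := by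
  rw [← val_addE _ c.isLt]
  congr 1
  funext i
  by_cases h : i = c
  · subst h
    simp only [addE, subE, if_true]
    omega
  · have : (i : ℕ) ≠ c := fun h' => h (Fin.ext h')
    simp [addE, subE, this]

lemma ordGT_subE {m : ℕ} (x : Fin m → ℕ) (c : Fin m) (hc : x c ≠ 0) :
    OrdGT m x (subE m x c) :=
  Or.inl (by have := sum_subE x c hc; omega)

lemma sum_addE_subE {m : ℕ} (x : Fin m → ℕ) (c : Fin m) (hc : x c ≠ 0)
    (hcm : (c : ℕ) + 1 < m) :
    ∑ i, addE m (subE m x c) (c + 1) i = ∑ i, x i := by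
  rw [sum_addE _ hcm, sum_subE x c hc]

lemma ordGT_addE_subE {m : ℕ} (x : Fin m → ℕ) (c : Fin m) (hc : x c ≠ 0)
    (hcm : (c : ℕ) + 1 < m) : OrdGT m x (addE m (subE m x c) (c + 1)) := by
  refine Or.inr ⟨(sum_addE_subE x c hc hcm).symm, ?_⟩
  rw [val_addE _ hcm, ← val_subE x c hc]
  gcongr <;> omega

lemma OrdGT.asymm {m : ℕ} {x y : Fin m → ℕ} (h : OrdGT m x y) : ¬ OrdGT m y x := by
  unfold OrdGT at *
  omega

lemma sum_fullVec {m : ℕ} (hm : 2 ≤ m) : ∑ i, fullVec m i = m := by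
  obtain ⟨n, rfl⟩ : ∃ n, m = n + 1 := ⟨m - 1, by omega⟩
  simp [fullVec]

lemma not_ordGT_fullVec {m : ℕ} (hm : 2 ≤ m) {x : Fin m → ℕ} (hx : ∑ i, x i ≤ m) :
    ¬ OrdGT m x (fullVec m) := by
  have hval : val m (fullVec m) = m * (m + 1) ^ (m - 1) := by
    obtain ⟨n, rfl⟩ : ∃ n, m = n + 1 := ⟨m - 1, by omega⟩
    simp [val, fullVec]
  have hle : val m x ≤ m * (m + 1) ^ (m - 1) :=
    calc val m x ≤ ∑ i, x i * (m + 1) ^ (m - 1) := by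
          refine Finset.sum_le_sum fun i _ => Nat.mul_le_mul_left _ ?_
          exact Nat.pow_le_pow_right (by omega) (by omega)
      _ = (∑ i, x i) * (m + 1) ^ (m - 1) := (Finset.sum_mul _ _ _).symm
      _ ≤ _ := by gcongr
  rintro (h | ⟨-, h⟩)
  · rw [sum_fullVec hm] at h
    omega
  · omega

/-- The hypotheses on an enumeration `τ` of the composite types and its inverse. -/
structure IsEnumeration (m N : ℕ) (τ : Fin N → Fin m → ℕ) (τinv : (Fin m → ℕ) → Fin N) :
    Prop where
  injective : Function.Injective τ
  sum_le : ∀ s, ∑ i, τ s i ≤ m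
  ordGT : ∀ i j : Fin N, i < j → OrdGT m (τ i) (τ j)
  right_inv : ∀ x : Fin m → ℕ, (∑ i, x i) ≤ m → τ (τinv x) = x

namespace IsEnumeration

variable {m N : ℕ} {τ : Fin N → Fin m → ℕ} {τinv : (Fin m → ℕ) → Fin N}

lemma left_inv (h : IsEnumeration m N τ τinv) (s : Fin N) : τinv (τ s) = s :=
  h.injective (h.right_inv _ (h.sum_le s))

lemma lt_of_ordGT (h : IsEnumeration m N τ τinv) {s : Fin N} {y : Fin m → ℕ}
    (hy : ∑ i, y i ≤ m) (hs : OrdGT m (τ s) y) : s < τinv y := by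
  by_contra hlt
  rcases (not_lt.1 hlt).lt_or_eq with hlt | heq
  · have := h.ordGT _ _ hlt
    rw [h.right_inv y hy] at this
    exact hs.asymm this
  · have : τ s = y := by rw [← heq, h.right_inv y hy]
    rw [this] at hs
    exact hs.asymm hs

lemma τinv_fullVec (h : IsEnumeration m N τ τinv) (hm : 2 ≤ m) :
    (τinv (fullVec m) : ℕ) = 0 := by
  by_contra h0
  have hN : 0 < N := (Nat.zero_le _).trans_lt (τinv (fullVec m)).isLt
  have := h.ordGT ⟨0, hN⟩ (τinv (fullVec m)) (Fin.lt_def.2 (Nat.pos_of_ne_zero h0))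
  rw [h.right_inv _ (sum_fullVec hm).le] at this
  exact not_ordGT_fullVec hm (h.sum_le _) this

lemma τ_zero (h : IsEnumeration m N τ τinv) (hm : 2 ≤ m) (s : Fin N) (hs : (s : ℕ) = 0) :
    τ s = fullVec m := by
  have : s = τinv (fullVec m) := Fin.ext (by rw [hs, h.τinv_fullVec hm])
  rw [this, h.right_inv _ (sum_fullVec hm).le]

end IsEnumeration

/-- A composite type minus the balls left after deleting its root. -/
noncomputable def rootDiff (m N : ℕ) (hm : 2 ≤ m) (τinv : (Fin m → ℕ) → Fin N) (k : ℕ)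
    (x : Fin m → ℕ) : Fin k → ℝ := fun i =>
  red m N hm τinv k x i - singles m k hm x i

/-- The composite type of a ball with global index `j`. -/
def typeAt {m N : ℕ} (τ : Fin N → Fin m → ℕ) {k : ℕ} (hk : k ≤ m - 1 + N) (j : Fin k)
    (hj : m - 1 ≤ (j : ℕ)) : Fin m → ℕ :=
  τ ⟨(j : ℕ) - (m - 1), by have := j.isLt; omega⟩

/-- The change of basis replacing each composite type by its `rootDiff`. -/
noncomputable def basisMatrix (m N : ℕ) (hm : 2 ≤ m) (τ : Fin N → Fin m → ℕ)
    (τinv : (Fin m → ℕ) → Fin N) (k : ℕ) (hk : k ≤ m - 1 + N) :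
    Matrix (Fin k) (Fin k) ℝ :=
  Matrix.of fun i j =>
    if hj : m - 1 ≤ (j : ℕ) then rootDiff m N hm τinv k (typeAt τ hk j hj) i
    else if (i : ℕ) = j then 1 else 0

/-- The intensity matrix in the basis given by `basisMatrix`. -/
noncomputable def triangularMatrix (m N : ℕ) (hm : 2 ≤ m) (τ : Fin N → Fin m → ℕ)
    (τinv : (Fin m → ℕ) → Fin N) (k : ℕ) (hk : k ≤ m - 1 + N) :
    Matrix (Fin k) (Fin k) ℝ :=
  Matrix.of fun i j =>
    if hj : m - 1 ≤ (j : ℕ) then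
      (∑ c : Fin (m - 1),
        (((c : ℕ) : ℝ) + 1) * (typeAt τ hk j hj (Fin.castLE (by omega) c) : ℝ) *
          (if (i : ℕ) = m - 1 + (τinv (addE m (subE m (typeAt τ hk j hj) c) (c + 1)) : ℕ)
            then 1 else 0))
      + (m : ℝ) * (typeAt τ hk j hj ⟨m - 1, by omega⟩ : ℝ) *
          (if (i : ℕ) = m - 1 + (τinv (subE m (typeAt τ hk j hj) (m - 1)) : ℕ) then 1 else 0)
      - (activity m (typeAt τ hk j hj) : ℝ) * (if (i : ℕ) = j then 1 else 0)
    else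
      (((j : ℕ) : ℝ) + 1) *
        ((if (i : ℕ) = (j : ℕ) + 1 then 1 else 0) - (if (i : ℕ) = j then 1 else 0)
          + (if (j : ℕ) = m - 2 then (m : ℝ) else 0) * (if (i : ℕ) = 0 then 1 else 0))

lemma activity_eq {m : ℕ} (hm : 2 ≤ m) (x : Fin m → ℕ) :
    (activity m x : ℝ) = ∑ c : Fin (m - 1), (((c : ℕ) : ℝ) + 1) * x (Fin.castLE (by omega) c)
      + (m : ℝ) * x ⟨m - 1, by omega⟩ := by
  have h1 : ((m - 1 : ℕ) : ℝ) + 1 = m := by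
    rw [Nat.cast_sub (by omega)]
    simp
  rw [activity]
  push_cast
  rw [sum_fin_eq_sum_castLE_add hm]
  simp [h1]

section Conjugation

variable {m N : ℕ} (hm : 2 ≤ m) {τ : Fin N → Fin m → ℕ} {τinv : (Fin m → ℕ) → Fin N}
  {k : ℕ} (hk : k ≤ m - 1 + N)

lemma red_fullVec (hmk : m ≤ k) (h : IsEnumeration m N τ τinv) (i : Fin k) :
    red m N hm τinv k (fullVec m) i = if (i : ℕ) = m - 1 then 1 else 0 := by
  have : m - 1 < k := by omega
  simp [red, h.τinv_fullVec hm, this]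

lemma red_typeAt (h : IsEnumeration m N τ τinv) (i j : Fin k) (hj : m - 1 ≤ (j : ℕ)) :
    red m N hm τinv k (typeAt τ hk j hj) i = if (i : ℕ) = j then 1 else 0 := by
  have h1 : m - 1 + ((j : ℕ) - (m - 1)) = j := by omega
  simp [red, typeAt, h.left_inv, h1]

lemma basisMatrix_of_le (i j : Fin k) (hj : m - 1 ≤ (j : ℕ)) :
    basisMatrix m N hm τ τinv k hk i j = rootDiff m N hm τinv k (typeAt τ hk j hj) i := by
  rw [basisMatrix, Matrix.of_apply, dif_pos hj]

lemma basisMatrix_of_lt (i j : Fin k) (hj : (j : ℕ) < m - 1) :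
    basisMatrix m N hm τ τinv k hk i j = if (i : ℕ) = j then 1 else 0 := by
  rw [basisMatrix, Matrix.of_apply, dif_neg hj.not_ge]

lemma triangularMatrix_of_lt (i j : Fin k) (hj : (j : ℕ) < m - 1) :
    triangularMatrix m N hm τ τinv k hk i j
      = (((j : ℕ) : ℝ) + 1) *
        ((if (i : ℕ) = (j : ℕ) + 1 then 1 else 0) - (if (i : ℕ) = j then 1 else 0)
          + (if (j : ℕ) = m - 2 then (m : ℝ) else 0) * (if (i : ℕ) = 0 then 1 else 0)) := by
  rw [triangularMatrix, Matrix.of_apply, dif_neg hj.not_ge]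

lemma sum_basisMatrix_mul_ite (h : IsEnumeration m N τ τinv) (l : Fin k) {y : Fin m → ℕ}
    (hy : ∑ i, y i ≤ m) :
    ∑ i, basisMatrix m N hm τ τinv k hk l i *
      (if (i : ℕ) = m - 1 + (τinv y : ℕ) then 1 else 0) = rootDiff m N hm τinv k y l := by
  rw [sum_mul_ite_val_eq]
  split_ifs with hlt
  · simp only [basisMatrix, Matrix.of_apply, typeAt, Nat.le_add_right, dif_pos,
      Nat.add_sub_cancel_left, Fin.eta, h.right_inv y hy]
  · simp [rootDiff, red, hlt]

lemma intensityProt_single (hmk : m ≤ k) (h : IsEnumeration m N τ τinv) (l j : Fin k)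
    (hj : (j : ℕ) < m - 1) :
    intensityProt m N hm τ τinv k hk l j
      = (((j : ℕ) : ℝ) + 1) *
        ((if (l : ℕ) = (j : ℕ) + 1 then 1 else 0) - (if (l : ℕ) = j then 1 else 0)) := by
  by_cases h1 : (j : ℕ) < m - 2
  · simp [intensityProt, h1, Fin.ext_iff]
  · have h2 : (j : ℕ) = m - 2 := by omega
    have h3 : m - 2 + 1 = m - 1 := by omega
    have h4 : ((m - 2 : ℕ) : ℝ) + 1 = m - 1 := by
      rw [Nat.cast_sub hm]
      push_cast
      ring
    simp [intensityProt, h2, Fin.ext_iff, red_fullVec hm hmk h, h3, h4]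

lemma intensityProt_composite (l j : Fin k) (hj : m - 1 ≤ (j : ℕ)) :
    intensityProt m N hm τ τinv k hk l j
      = (∑ c : Fin (m - 1),
        (((c : ℕ) : ℝ) + 1) * (typeAt τ hk j hj (Fin.castLE (by omega) c) : ℝ) *
          red m N hm τinv k (addE m (subE m (typeAt τ hk j hj) c) (c + 1)) l)
      + (m : ℝ) * (typeAt τ hk j hj ⟨m - 1, by omega⟩ : ℝ) *
          (red m N hm τinv k (subE m (typeAt τ hk j hj) (m - 1)) l
            + red m N hm τinv k (spawnVec m) l)
      - (activity m (typeAt τ hk j hj) : ℝ) * (if (l : ℕ) = j then 1 else 0) := by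
  have h1 : ¬ (j : ℕ) < m - 2 := by omega
  have h2 : ¬ (j : ℕ) = m - 2 := by omega
  simp [intensityProt, h1, h2, Fin.ext_iff, typeAt]

lemma addE_subE_fullVec (m : ℕ) : addE m (subE m (fullVec m) 0) 1 = spawnVec m := by
  funext i
  by_cases h0 : (i : ℕ) = 0
  · simp [addE, subE, fullVec, spawnVec, h0]
  · by_cases h1 : (i : ℕ) = 1 <;> simp [addE, subE, fullVec, spawnVec, h0, h1]

lemma intensityProt_full (h : IsEnumeration m N τ τinv) (l j : Fin k) (hj : (j : ℕ) = m - 1) :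
    intensityProt m N hm τ τinv k hk l j
      = (m : ℝ) * (red m N hm τinv k (spawnVec m) l - if (l : ℕ) = m - 1 then 1 else 0) := by
  have hfull : typeAt τ hk j hj.ge = fullVec m := h.τ_zero hm _ (by simp [hj])
  have h1 : m - 1 ≠ 0 := by omega
  rw [intensityProt_composite hm hk l j hj.ge, activity_eq hm, hfull,
    Finset.sum_eq_single (⟨0, by omega⟩ : Fin (m - 1)),
    Finset.sum_eq_single (⟨0, by omega⟩ : Fin (m - 1))]
  · simp [addE_subE_fullVec m, fullVec, h1, hj, mul_sub]
  all_goals simp +contextual [fullVec, Fin.ext_iff]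

lemma intensityProt_mul_rootDiff (hmk : m ≤ k) (h : IsEnumeration m N τ τinv) (l j : Fin k)
    (hj : m - 1 ≤ (j : ℕ)) :
    ∑ i, intensityProt m N hm τ τinv k hk l i * rootDiff m N hm τinv k (typeAt τ hk j hj) i
      = (∑ c : Fin (m - 1),
        (((c : ℕ) : ℝ) + 1) * (typeAt τ hk j hj (Fin.castLE (by omega) c) : ℝ) *
          rootDiff m N hm τinv k (addE m (subE m (typeAt τ hk j hj) c) (c + 1)) l)
      + (m : ℝ) * (typeAt τ hk j hj ⟨m - 1, by omega⟩ : ℝ) *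
          rootDiff m N hm τinv k (subE m (typeAt τ hk j hj) (m - 1)) l
      - (activity m (typeAt τ hk j hj) : ℝ) *
          rootDiff m N hm τinv k (typeAt τ hk j hj) l := by
  have hred : ∑ i, intensityProt m N hm τ τinv k hk l i *
      red m N hm τinv k (typeAt τ hk j hj) i = intensityProt m N hm τ τinv k hk l j := by
    simp_rw [red_typeAt hm hk h, sum_mul_ite_val_eq]
    simp
  simp only [rootDiff, mul_sub, Finset.sum_sub_distrib]
  rw [hred, intensityProt_composite hm hk l j hj, red_typeAt hm hk h, sum_mul_singles hm hmk,
    sum_fin_eq_sum_castLE_add hm, intensityProt_full hm hk h _ _ rfl]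
  set x := typeAt τ hk j hj
  have hlight : ∀ c : Fin (m - 1),
      (((c : ℕ) : ℝ) + 1) * (x (Fin.castLE (by omega) c) : ℝ) *
          singles m k hm (addE m (subE m x c) (c + 1)) l
        = (((c : ℕ) : ℝ) + 1) * (x (Fin.castLE (by omega) c) : ℝ) * singles m k hm x l
          + intensityProt m N hm τ τinv k hk l (Fin.castLE hmk (Fin.castLE (by omega) c))
            * (x (Fin.castLE (by omega) c) : ℝ) := by
    intro c
    rw [intensityProt_single hm hk hmk h _ _ c.isLt]
    by_cases hc : x (Fin.castLE (by omega) c) = 0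
    · simp [hc]
    · have hsub := singles_subE hm hmk x _ hc l
      rw [Fin.val_castLE] at hsub
      rw [singles_addE hm hmk _ (by omega), hsub]
      simp only [Fin.val_castLE]
      ring
  have hfull : (m : ℝ) * (x ⟨m - 1, by omega⟩ : ℝ) * singles m k hm (subE m x (m - 1)) l
      = (m : ℝ) * (x ⟨m - 1, by omega⟩ : ℝ) *
        (singles m k hm x l - if (l : ℕ) = m - 1 then 1 else 0) := by
    by_cases hc : x ⟨m - 1, by omega⟩ = 0
    · simp [hc]
    · rw [← singles_subE hm hmk x _ hc l]
  rw [Finset.sum_congr rfl fun c _ => hlight c, Finset.sum_add_distrib, ← Finset.sum_mul]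
  rw [hfull, activity_eq hm]
  ring

lemma sum_addE_subE_typeAt_le (h : IsEnumeration m N τ τinv) (j : Fin k)
    (hj : m - 1 ≤ (j : ℕ)) (c : Fin (m - 1))
    (hc : typeAt τ hk j hj (Fin.castLE (by omega) c) ≠ 0) :
    ∑ i, addE m (subE m (typeAt τ hk j hj) c) (c + 1) i ≤ m :=
  (sum_addE_subE _ (Fin.castLE (by omega) c) hc (by simp; omega)).trans_le (h.sum_le _)

lemma sum_subE_typeAt_le (h : IsEnumeration m N τ τinv) (j : Fin k)
    (hj : m - 1 ≤ (j : ℕ)) (hc : typeAt τ hk j hj ⟨m - 1, by omega⟩ ≠ 0) :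
    ∑ i, subE m (typeAt τ hk j hj) (m - 1) i ≤ m := by
  have h1 := sum_subE _ _ hc
  have h2 : ∑ i, typeAt τ hk j hj i ≤ m := h.sum_le _
  simp only at h1
  omega

lemma intensityProt_mul_basisMatrix (hmk : m ≤ k) (h : IsEnumeration m N τ τinv) :
    intensityProt m N hm τ τinv k hk * basisMatrix m N hm τ τinv k hk
      = basisMatrix m N hm τ τinv k hk * triangularMatrix m N hm τ τinv k hk := by
  ext l j
  rw [Matrix.mul_apply, Matrix.mul_apply]
  by_cases hj : m - 1 ≤ (j : ℕ)
  · have hQ : ∀ i, basisMatrix m N hm τ τinv k hk i j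
        = rootDiff m N hm τinv k (typeAt τ hk j hj) i := fun i => basisMatrix_of_le hm hk i j hj
    simp_rw [hQ]
    rw [intensityProt_mul_rootDiff hm hk hmk h]
    simp only [triangularMatrix, Matrix.of_apply, hj, dif_pos, mul_sub, mul_add,
      Finset.sum_sub_distrib, Finset.sum_add_distrib, Finset.mul_sum]
    rw [Finset.sum_comm]
    simp_rw [mul_left_comm (basisMatrix m N hm τ τinv k hk l _), ← Finset.mul_sum]
    congr 1
    · congr 1
      · refine Finset.sum_congr rfl fun c _ => ?_
        by_cases hc : typeAt τ hk j hj (Fin.castLE (by omega) c) = 0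
        · simp [hc]
        · rw [sum_basisMatrix_mul_ite hm hk h l (sum_addE_subE_typeAt_le hm hk h j hj c hc)]
      · by_cases hc : typeAt τ hk j hj ⟨m - 1, by omega⟩ = 0
        · simp [hc]
        · rw [sum_basisMatrix_mul_ite hm hk h l (sum_subE_typeAt_le hm hk h j hj hc)]
    · rw [sum_mul_ite_val_eq]
      simp [hQ]
  · have hj' : (j : ℕ) < m - 1 := by omega
    have hQ : ∀ i, basisMatrix m N hm τ τinv k hk i j = if (i : ℕ) = j then 1 else 0 :=
      fun i => basisMatrix_of_lt hm hk i j hj'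
    have hQ0 : ∀ i : Fin k, basisMatrix m N hm τ τinv k hk i ⟨0, by omega⟩
        = if (i : ℕ) = 0 then 1 else 0 := fun i =>
      basisMatrix_of_lt hm hk i _ (by simp; omega)
    have hk0 : 0 < k := by omega
    have hjk : (j : ℕ) + 1 < k := by omega
    simp_rw [hQ]
    rw [sum_mul_ite_val_eq, dif_pos j.isLt, intensityProt_single hm hk hmk h l _ hj']
    simp_rw [triangularMatrix_of_lt hm hk _ j hj', mul_left_comm (basisMatrix m N hm τ τinv k hk l _), ← Finset.mul_sum]
    congr 1
    simp_rw [mul_add, mul_sub, Finset.sum_add_distrib, Finset.sum_sub_distrib,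
      mul_left_comm (basisMatrix m N hm τ τinv k hk l _), ← Finset.mul_sum, sum_mul_ite_val_eq]
    rw [dif_pos hjk, dif_pos j.isLt, dif_pos hk0, hQ0, Fin.eta, hQ]
    by_cases hlast : (j : ℕ) = m - 2
    · have hjm : (j : ℕ) + 1 = m - 1 := by omega
      have hle : m - 1 ≤ (j : ℕ) + 1 := by omega
      have hfull : typeAt τ hk (⟨(j : ℕ) + 1, hjk⟩ : Fin k) hle = fullVec m :=
        h.τ_zero hm _ (by simp [hjm])
      rw [basisMatrix_of_le hm hk _ _ hle, hfull, rootDiff, red_fullVec hm hmk h,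
        singles_fullVec hm hmk, if_pos hlast, hjm]
      by_cases hl : (l : ℕ) = 0 <;> simp only [hl, if_true, if_false] <;> ring
    · rw [basisMatrix_of_lt hm hk _ _ (by simp; omega), if_neg hlast, zero_mul, add_zero]

lemma isUnit_det_basisMatrix (hmk : m ≤ k) (h : IsEnumeration m N τ τinv) :
    IsUnit (basisMatrix m N hm τ τinv k hk).det := by
  rw [Matrix.det_of_isUpperTriangular, Finset.prod_eq_one]
  · exact isUnit_one
  · intro j _
    by_cases hj : m - 1 ≤ (j : ℕ)
    · have hsing : singles m k hm (typeAt τ hk j hj) j = 0 := by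
        rcases hj.eq_or_lt with heq | hlt
        · have hfull : typeAt τ hk j hj = fullVec m := h.τ_zero hm _ (by simp [heq])
          rw [hfull, singles_fullVec hm hmk, if_neg (by omega)]
        · rw [singles_apply hm hmk, dif_neg (by omega)]
      simp [basisMatrix_of_le hm hk _ _ hj, rootDiff, red_typeAt hm hk h, hsing]
    · simp [basisMatrix_of_lt hm hk _ _ (not_le.1 hj)]
  · intro i j hij
    have hij : (j : ℕ) < i := hij
    by_cases hj : m - 1 ≤ (j : ℕ)
    · have hsing : singles m k hm (typeAt τ hk j hj) i = 0 := by
        rw [singles_apply hm hmk, dif_neg (by omega)]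
      simp [basisMatrix_of_le hm hk _ _ hj, rootDiff, red_typeAt hm hk h, hsing, hij.ne']
    · simp [basisMatrix_of_lt hm hk _ _ (not_le.1 hj), hij.ne']

lemma triangularMatrix_of_le (h : IsEnumeration m N τ τinv) (i j : Fin k)
    (hj : m - 1 ≤ (j : ℕ)) (hij : i ≤ j) :
    triangularMatrix m N hm τ τinv k hk i j
      = if i = j then -(activity m (typeAt τ hk j hj) : ℝ) else 0 := by
  have hij : (i : ℕ) ≤ j := hij
  simp only [triangularMatrix, Matrix.of_apply, hj, dif_pos]
  rw [Finset.sum_eq_zero, zero_add]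
  · have : (m : ℝ) * (typeAt τ hk j hj ⟨m - 1, by omega⟩ : ℝ) *
        (if (i : ℕ) = m - 1 + (τinv (subE m (typeAt τ hk j hj) (m - 1)) : ℕ) then 1 else 0)
        = 0 := by
      by_cases hc : typeAt τ hk j hj ⟨m - 1, by omega⟩ = 0
      · simp [hc]
      · have := Fin.lt_def.1 (h.lt_of_ordGT (sum_subE_typeAt_le hm hk h j hj hc)
          (ordGT_subE _ _ hc))
        simp only at this
        rw [if_neg (by omega), mul_zero]
    rw [this]
    by_cases heq : i = j
    · simp [heq]
    · have : (i : ℕ) ≠ j := fun h' => heq (Fin.ext h')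
      simp [heq, this]
  · intro c _
    by_cases hc : typeAt τ hk j hj (Fin.castLE (by omega) c) = 0
    · simp [hc]
    · have := Fin.lt_def.1 (h.lt_of_ordGT (sum_addE_subE_typeAt_le hm hk h j hj c hc)
        (ordGT_addE_subE _ _ hc (by simp; omega)))
      simp only at this
      rw [if_neg (by omega), mul_zero]

lemma det_charmatrix_composite (h : IsEnumeration m N τ τinv) :
    (Matrix.toSquareBlockProp (Matrix.charmatrix (triangularMatrix m N hm τ τinv k hk))
        fun i => ¬ (i : ℕ) < m - 1).det
      = ∏ i ∈ Finset.univ.filter (fun i : Fin k => m - 1 ≤ (i : ℕ)),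
          (X + C (actGlobal m N τ k hk i)) := by
  rw [Matrix.det_of_isLowerTriangular]
  · refine (Finset.prod_subtype (Finset.univ.filter (fun i : Fin k => m - 1 ≤ (i : ℕ)))
      (by simp) fun i => Matrix.charmatrix (triangularMatrix m N hm τ τinv k hk) i i).symm.trans ?_
    refine Finset.prod_congr rfl fun j hj => ?_
    have hj : m - 1 ≤ (j : ℕ) := by simpa using hj
    rw [Matrix.charmatrix_apply_eq, triangularMatrix_of_le hm hk h j j hj le_rfl]
    simp [actGlobal, hj.not_gt, typeAt]
  · rintro ⟨i, hi⟩ ⟨j, hj⟩ hij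
    have hij : i < j := hij
    have := triangularMatrix_of_le hm hk h i j (not_lt.1 hj) hij.le
    rw [if_neg hij.ne] at this
    simp [Matrix.toSquareBlockProp, Matrix.charmatrix_apply_ne _ _ _ hij.ne, this]

lemma det_charmatrix_single (hmk : m ≤ k) :
    (Matrix.toSquareBlockProp (Matrix.charmatrix (triangularMatrix m N hm τ τinv k hk))
        fun i => (i : ℕ) < m - 1).det
      = (∏ i ∈ Finset.range (m - 1), (X + C (((i : ℕ) : ℝ) + 1)))
          - C ((Nat.factorial m : ℝ)) := by
  obtain ⟨n, rfl⟩ : ∃ n, m = n + 2 := ⟨m - 2, by omega⟩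
  let e : Fin (n + 1) ≃ {i : Fin k // (i : ℕ) < n + 2 - 1} :=
    { toFun := fun i => ⟨⟨i, by omega⟩, i.isLt⟩
      invFun := fun i => ⟨i.1, i.2⟩
      left_inv := fun _ => rfl
      right_inv := fun _ => rfl }
  have hblock : (Matrix.toSquareBlockProp
      (Matrix.charmatrix (triangularMatrix (n + 2) N hm τ τinv k hk))
        fun i => (i : ℕ) < n + 2 - 1).submatrix e e
      = Matrix.of fun i j : Fin (n + 1) =>
      (if i = j then X + C (((i : ℕ) : ℝ) + 1) else 0)
        + (if (i : ℕ) = j + 1 then -C (((j : ℕ) : ℝ) + 1) else 0)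
        + (if i = 0 ∧ j = Fin.last n then -C (((n : ℝ) + 1) * (n + 2)) else 0) := by
    ext1 i j
    have hentry : (Matrix.toSquareBlockProp
        (Matrix.charmatrix (triangularMatrix (n + 2) N hm τ τinv k hk))
          fun i => (i : ℕ) < n + 2 - 1).submatrix e e i j
        = Matrix.charmatrix (triangularMatrix (n + 2) N hm τ τinv k hk)
          ⟨i, by omega⟩ ⟨j, by omega⟩ := rfl
    rw [hentry, Matrix.charmatrix_apply, triangularMatrix_of_lt hm hk _ _ j.isLt]
    simp only [Matrix.diagonal_apply, Matrix.of_apply, Fin.ext_iff, Fin.val_zero,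
      Nat.add_sub_cancel]
    split_ifs <;> simp_all <;> ring
  rw [← Matrix.det_submatrix_equiv_self e, hblock,
    det_bidiagonal_add_corner n (fun i => X + C ((i : ℝ) + 1)) (fun j => -C ((j : ℝ) + 1))]
  have hfact : ∏ j : Fin n, (((j : ℕ) : ℝ) + 1) = (n.factorial : ℝ) := by
    rw [Fin.prod_univ_eq_prod_range (fun j => (j : ℝ) + 1), ← Finset.prod_range_add_one_eq_factorial]
    push_cast
    rfl
  have hneg : ((-1 : ℝ[X]) ^ n) * (-1) ^ n = 1 := by rw [← mul_pow]; simp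
  rw [Fin.prod_univ_eq_prod_range (fun i => X + C ((i : ℝ) + 1)), Finset.prod_neg, ← map_prod,
    hfact, Finset.card_univ, Fintype.card_fin, Nat.factorial_succ, Nat.factorial_succ]
  push_cast
  simp only [map_mul, map_add, map_one, map_ofNat]
  linear_combination (-(C (n : ℝ) + 1) * (C (n : ℝ) + 2) * C (n.factorial : ℝ)) * hneg

theorem charpoly_intensityProt (hmk : m ≤ k) (h : IsEnumeration m N τ τinv) :
    (intensityProt m N hm τ τinv k hk).charpoly
      = ((∏ i ∈ Finset.range (m - 1), (X + C (((i : ℕ) : ℝ) + 1)))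
            - C ((Nat.factorial m : ℝ)))
        * ∏ i ∈ Finset.univ.filter (fun i : Fin k => m - 1 ≤ (i : ℕ)),
            (X + C (actGlobal m N τ k hk i)) := by
  rw [charpoly_eq_of_mul_eq_mul (isUnit_det_basisMatrix hm hk hmk h)
      (intensityProt_mul_basisMatrix hm hk hmk h), Matrix.charpoly,
    Matrix.twoBlockTriangular_det' _ (fun i : Fin k => (i : ℕ) < m - 1),
    det_charmatrix_single hm hk hmk, det_charmatrix_composite hm hk h]
  intro i hi j hj
  have hij : i < j := Fin.lt_def.2 (by omega)
  have := triangularMatrix_of_le hm hk h i j (not_lt.1 hj) hij.le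
  rw [if_neg hij.ne] at this
  simp [Matrix.charmatrix_apply_ne _ _ _ hij.ne, this]

end Conjugation

/-- **Theorem (eigenvalues of the protected-nodes urn).** Let `m ≥ 2` and
`q = m − 1 + C(2m, m)`. The eigenvalues of the intensity matrix `A_{q−m−1}` of the
reduced Pólya urn (with the dead type and the `m` single-root types removed, i.e.
with `k = q − m − 1 = C(2m, m) − 2` types) used to count protected nodes in the
random `m`-ary search tree are, counted with algebraic multiplicity, the roots of
`φ_m(λ) = Π_{i=1}^{m−1}(λ + i) − m!` together with the multiset
`{−a_i : i = m, …, q − m − 1}` (stated as a factorization of the characteristic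
polynomial; indices in Lean are 0-based, so the composite types are those with
index `≥ m − 1`). -/
theorem protUrn_eigenvalues (m N : ℕ) (hm : 2 ≤ m) (hN : N = (2 * m).choose m)
    (τ : Fin N → Fin m → ℕ) (τinv : (Fin m → ℕ) → Fin N)
    (hinj : Function.Injective τ)
    (hrange : ∀ x : Fin m → ℕ, x ∈ Set.range τ ↔ ∑ i, x i ≤ m)
    (horder : ∀ i j : Fin N, i < j → OrdGT m (τ i) (τ j))
    (hτinv : ∀ x : Fin m → ℕ, (∑ i, x i) ≤ m → τ (τinv x) = x) :
    (intensityProt m N hm τ τinv (N - 2) (by omega)).charpoly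
      = ((∏ i ∈ Finset.range (m - 1), (X + C (((i : ℕ) : ℝ) + 1)))
            - C ((Nat.factorial m : ℝ)))
        * ∏ i ∈ Finset.univ.filter (fun i : Fin (N - 2) => m - 1 ≤ (i : ℕ)),
            (X + C (actGlobal m N τ (N - 2) (by omega) i)) := by
  have hN2 : m ≤ N - 2 := by
    have := Nat.choose_le_centralBinom 1 m
    rw [Nat.choose_one_right, Nat.centralBinom_eq_two_mul_choose] at this
    omega
  exact charpoly_intensityProt hm (by omega) hN2
    ⟨hinj, fun s => (hrange _).1 ⟨s, rfl⟩, horder, hτinv⟩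

end ProtUrn
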